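/- arXiv:1905.06107 — 2 statements merged into one kernel-verified Lean document; each statement's English description precedes it below -/
import Mathlib

section
/- Fix $n \ge 3$ and $a \in (0,1)$. There exists $d_0 > 0$ such that for every $d \in (0, d_0)$, exactly $2^n$ of the stationary solutions of the cyclic system $d(\mathrm{u}_{i-1} - 2\mathrm{u}_i + \mathrm{u}_{i+1}) + g(\mathrm{u}_i;a) = 0$ (indices mod $n$) are asymptotically stable equilibria of the ODE $\dot{\mathrm{u}} = G(\mathrm{u};a,d)$ on $\mathbb{R}^n$, namely the solutions lying on the branches emanating from the $2^n$ roots in $\{0,1\}^n$; the solutions on branches emanating from roots having at least one entry equal to $a$ are not asymptotically stable. -/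
open Filter

/-- The cubic bistable nonlinearity `g(u; a) = u(1-u)(u-a)`. -/
noncomputable def g (a u : ℝ) : ℝ := u * (1 - u) * (u - a)

/-- The right-hand side of the Nagumo equation on the cycle graph `C_n`. -/
noncomputable def GF (n : ℕ) (a d : ℝ) (v : ZMod n → ℝ) : ZMod n → ℝ :=
  fun i => d * (v (i - 1) - 2 * v i + v (i + 1)) + g a (v i)

/-- A solution (for `t ≥ 0`) of the graph Nagumo ODE `u' = G(u; a, d)` on `ℝⁿ`. -/
def IsODESol (n : ℕ) [NeZero n] (a d : ℝ) (V : ℝ → ZMod n → ℝ) : Prop :=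
  ∀ t : ℝ, 0 ≤ t → HasDerivAt V (GF n a d (V t)) t

/-- Asymptotic stability of an equilibrium `p` of the graph Nagumo ODE on `ℝⁿ`. -/
def ODEAsympStable (n : ℕ) [NeZero n] (a d : ℝ) (p : ZMod n → ℝ) : Prop :=
  (∀ ε > 0, ∃ δ > 0, ∀ V : ℝ → ZMod n → ℝ, IsODESol n a d V → ‖V 0 - p‖ < δ →
      ∀ t : ℝ, 0 ≤ t → ‖V t - p‖ < ε) ∧
  ∃ δ > 0, ∀ V : ℝ → ZMod n → ℝ, IsODESol n a d V → ‖V 0 - p‖ < δ →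
      Tendsto V atTop (nhds p)

section StationarySolutions

open Set

/-- A bounded Lipschitz autonomous vector field admits global integral curves. -/
theorem exists_global_solution_of_lipschitz_of_bounded {E : Type*} [NormedAddCommGroup E]
    [NormedSpace ℝ E] [CompleteSpace E] {F : E → E} {K L : NNReal} (hF : LipschitzWith K F)
    (hL : ∀ x, ‖F x‖ ≤ L) (x₀ : E) :
    ∃ V : ℝ → E, V 0 = x₀ ∧ ∀ t, HasDerivAt V (F (V t)) t := by
  have hloc : ∀ T : ℝ, ∃ γ : ℝ → E, γ 0 = x₀ ∧
      ∀ t ∈ Ioo (-T) T, HasDerivAt γ (F (γ t)) t := by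
    intro T
    rcases le_or_gt T 0 with hT | hT
    · exact ⟨fun _ => x₀, rfl, fun t ht => absurd (ht.1.trans ht.2) (by linarith)⟩
    have hPL : IsPicardLindelof (fun _ => F) (tmin := -T) (tmax := T)
        ⟨0, by constructor <;> linarith⟩ x₀ (L * T.toNNReal) 0 L K := by
      refine .of_time_independent (fun x _ => hL x) hF.lipschitzOnWith ?_
      simp [hT.le]
    obtain ⟨γ, h0, hγ⟩ := hPL.exists_eq_forall_mem_Icc_hasDerivWithinAt₀
    exact ⟨γ, h0, fun t ht =>
      (hγ t (Ioo_subset_Icc_self ht)).hasDerivAt (Icc_mem_nhds ht.1 ht.2)⟩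
  choose γ h0 hγ using hloc
  have heq : ∀ {S T : ℝ}, S ≤ T → EqOn (γ S) (γ T) (Ioo (-S) S) := by
    intro S T hST t ht
    have hS : 0 < S := by linarith [ht.1, ht.2]
    exact ODE_solution_unique_of_mem_Ioo (v := fun _ => F) (s := fun _ => univ) (K := K)
      (t₀ := 0) (fun _ _ => hF.lipschitzOnWith) ⟨by linarith, hS⟩
      (fun t ht => ⟨hγ S t ht, mem_univ _⟩)
      (fun t ht => ⟨hγ T t ⟨by linarith [ht.1], by linarith [ht.2]⟩, mem_univ _⟩)
      (by rw [h0, h0]) ht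
  refine ⟨fun t => γ (|t| + 1) t, h0 _, fun t => ?_⟩
  have ht : t ∈ Ioo (-(|t| + 1)) (|t| + 1) := abs_lt.mp (lt_add_one _)
  refine (hγ (|t| + 1) t ht).congr_of_eventuallyEq ?_
  filter_upwards [Ioo_mem_nhds ht.1 ht.2] with s hs
  have hs' : s ∈ Ioo (-(|s| + 1)) (|s| + 1) := abs_lt.mp (lt_add_one _)
  rcases le_total (|s| + 1) (|t| + 1) with h | h
  · exact heq h hs'
  · exact (heq h hs).symm

/-- Coordinatewise clamping of a vector to the cube `[-1, 2]ⁿ`. -/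
noncomputable def clampCube {ι : Type*} (v : ι → ℝ) : ι → ℝ := fun i => max (min (v i) 2) (-1)

theorem clampCube_mem {ι : Type*} (v : ι → ℝ) (i : ι) : clampCube v i ∈ Icc (-1 : ℝ) 2 :=
  ⟨le_max_right _ _, max_le (min_le_right _ _) (by norm_num)⟩

theorem clampCube_apply_of_mem {ι : Type*} {v : ι → ℝ} {i : ι} (h : v i ∈ Icc (-1 : ℝ) 2) :
    clampCube v i = v i := by
  simp [clampCube, h.1, h.2]

theorem abs_clampCube_sub_le {ι : Type*} (u v : ι → ℝ) (i : ι) :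
    |clampCube u i - clampCube v i| ≤ |u i - v i| :=
  (abs_max_sub_max_le_abs _ _ _).trans (abs_inf_sub_inf_le_abs (u i) (v i) 2)

/-- The difference quotient of the cubic nonlinearity. -/
noncomputable def gQuot (a u v : ℝ) : ℝ :=
  -(u ^ 2 + u * v + v ^ 2) + (1 + a) * (u + v) - a

theorem g_sub_g (a u v : ℝ) : g a u - g a v = gQuot a u v * (u - v) := by
  unfold g gQuot; ring

theorem GF_sub_GF {n : ℕ} {a d : ℝ} (u v : ZMod n → ℝ) (i : ZMod n) :
    GF n a d u i - GF n a d v i =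
      d * ((u (i - 1) - v (i - 1)) - 2 * (u i - v i) + (u (i + 1) - v (i + 1))) +
        gQuot a (u i) (v i) * (u i - v i) := by
  rw [← g_sub_g]
  unfold GF
  ring

variable {n : ℕ} [NeZero n] {a d : ℝ}

theorem lipschitzWith_GF_clampCube (ha : a ∈ Ioo (0 : ℝ) 1) (hd : 0 < d) :
    LipschitzWith (4 * d.toNNReal + 30) (fun v => GF n a d (clampCube v)) := by
  refine LipschitzWith.of_dist_le_mul fun u v => ?_
  rw [dist_pi_le_iff (by positivity)]
  intro i
  have hc : ∀ j, |clampCube u j - clampCube v j| ≤ dist u v := fun j =>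
    (abs_clampCube_sub_le u v j).trans (dist_le_pi_dist u v j)
  have hq : |gQuot a (clampCube u i) (clampCube v i)| ≤ 30 := by
    obtain ⟨hu1, hu2⟩ := clampCube_mem u i
    obtain ⟨hv1, hv2⟩ := clampCube_mem v i
    obtain ⟨ha1, ha2⟩ := ha
    unfold gQuot
    rw [abs_le]
    constructor <;> nlinarith
  have hg := g_sub_g a (clampCube u i) (clampCube v i)
  have hgq : |g a (clampCube u i) - g a (clampCube v i)| ≤ 30 * dist u v := by
    rw [hg, abs_mul]
    exact mul_le_mul hq (hc i) (abs_nonneg _) (by norm_num)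
  rw [Real.dist_eq]
  push_cast
  rw [Real.coe_toNNReal _ hd.le]
  have h1 := abs_le.mp (hc (i - 1))
  have h2 := abs_le.mp (hc i)
  have h3 := abs_le.mp (hc (i + 1))
  have h4 := abs_le.mp hgq
  unfold GF
  rw [abs_le]
  constructor <;> nlinarith

theorem norm_GF_clampCube_le (ha : a ∈ Ioo (0 : ℝ) 1) (hd : 0 < d) (v : ZMod n → ℝ) :
    ‖GF n a d (clampCube v)‖ ≤ (6 * d.toNNReal + 30 : NNReal) := by
  rw [pi_norm_le_iff_of_nonneg (by positivity)]
  intro i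
  push_cast
  rw [Real.coe_toNNReal _ hd.le, Real.norm_eq_abs]
  obtain ⟨h1, h2⟩ := clampCube_mem v i
  obtain ⟨h3, h4⟩ := clampCube_mem v (i - 1)
  obtain ⟨h5, h6⟩ := clampCube_mem v (i + 1)
  obtain ⟨ha1, ha2⟩ := ha
  have hg : |g a (clampCube v i)| ≤ 30 := by
    have e1 : |clampCube v i| ≤ 2 := abs_le.mpr ⟨by linarith, h2⟩
    have e2 : |1 - clampCube v i| ≤ 2 := abs_le.mpr ⟨by linarith, by linarith⟩
    have e3 : |clampCube v i - a| ≤ 2 := abs_le.mpr ⟨by linarith, by linarith⟩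
    unfold g
    rw [abs_mul, abs_mul]
    calc _ ≤ (2 : ℝ) * 2 * 2 := by gcongr
      _ ≤ 30 := by norm_num
  have h4 := abs_le.mp hg
  unfold GF
  rw [abs_le]
  constructor <;> nlinarith

/-- Forward global existence for initial data in the cube `[-1, 2]ⁿ`. -/
theorem exists_isODESol (ha : a ∈ Ioo (0 : ℝ) 1) (hd : 0 < d) {x₀ : ZMod n → ℝ}
    (hx₀ : ∀ i, x₀ i ∈ Icc (-1 : ℝ) 2) : ∃ V, IsODESol n a d V ∧ V 0 = x₀ := by
  obtain ⟨V, h0, hV⟩ := exists_global_solution_of_lipschitz_of_bounded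
    (lipschitzWith_GF_clampCube (n := n) ha hd) (norm_GF_clampCube_le ha hd) x₀
  have hVi : ∀ i t, HasDerivAt (fun s => V s i) (GF n a d (clampCube (V t)) i) t :=
    fun i t => hasDerivAt_pi.mp (hV t) i
  have hmem : ∀ t, 0 ≤ t → ∀ i, V t i ∈ Icc (-1 : ℝ) 2 := by
    intro t ht i
    constructor
    · have := image_le_of_deriv_right_lt_deriv_boundary (a := 0) (b := t)
        (f := fun s => -V s i) (B := fun _ => 1) (B' := fun _ => 0)
        (fun s _ => (hVi i s).neg.continuousAt.continuousWithinAt)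
        (fun s _ => (hVi i s).neg.hasDerivWithinAt)
        (by rw [h0]; linarith [(hx₀ i).1]) (fun _ => hasDerivAt_const _ _)
        (fun s _ hs => by
          have hs' : V s i = -1 := by linarith
          have hc : clampCube (V s) i = -1 := by rw [clampCube_apply_of_mem] <;> norm_num [hs']
          obtain ⟨h3, -⟩ := clampCube_mem (V s) (i - 1)
          obtain ⟨h5, -⟩ := clampCube_mem (V s) (i + 1)
          simp only [GF, g, hc]
          nlinarith [ha.1, ha.2])
        (right_mem_Icc.mpr ht)
      linarith
    · exact image_le_of_deriv_right_lt_deriv_boundary (a := 0) (b := t)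
        (f := fun s => V s i) (B := fun _ => 2) (B' := fun _ => 0)
        (fun s _ => (hVi i s).continuousAt.continuousWithinAt)
        (fun s _ => (hVi i s).hasDerivWithinAt)
        (by rw [h0]; exact (hx₀ i).2) (fun _ => hasDerivAt_const _ _)
        (fun s _ hs => by
          have hc : clampCube (V s) i = 2 := by rw [clampCube_apply_of_mem] <;> norm_num [hs]
          obtain ⟨-, h3⟩ := clampCube_mem (V s) (i - 1)
          obtain ⟨-, h5⟩ := clampCube_mem (V s) (i + 1)
          simp only [GF, g, hc]
          nlinarith [ha.1, ha.2])
        (right_mem_Icc.mpr ht)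
  refine ⟨V, fun t ht => ?_, h0⟩
  have hc : clampCube (V t) = V t := funext fun i => clampCube_apply_of_mem (hmem t ht i)
  simpa only [hc] using hV t

/-- The radius of the neighbourhoods of the roots in `{0, a, 1}ⁿ`. -/
noncomputable def rootRadius (a : ℝ) : ℝ := a * (1 - a) / 14

theorem rootRadius_pos (ha : a ∈ Ioo (0 : ℝ) 1) : 0 < rootRadius a := by
  have := mul_pos ha.1 (sub_pos.mpr ha.2)
  unfold rootRadius
  positivity

theorem rootRadius_le (a : ℝ) : rootRadius a ≤ 1 / 56 := by
  unfold rootRadius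
  nlinarith [sq_nonneg (a - 1 / 2)]

/-- The sign of the derivative of the nonlinearity at a root `w ∈ {0, a, 1}`. -/
noncomputable def rootSign (a w : ℝ) : ℝ := if w = a then 1 else -1

theorem rootSign_eq_or (a w : ℝ) : rootSign a w = 1 ∨ rootSign a w = -1 := by
  unfold rootSign
  split_ifs <;> simp

theorem rootSign_mul_gQuot_mem (ha : a ∈ Ioo (0 : ℝ) 1) {w u v : ℝ} (hw : w = 0 ∨ w = a ∨ w = 1)
    (hu : |u - w| ≤ rootRadius a) (hv : |v - w| ≤ rootRadius a) :
    rootSign a w * gQuot a u v ∈ Icc (7 * rootRadius a) 2 := by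
  have hpos := rootRadius_pos ha
  have hle := rootRadius_le a
  have hdef : a * (1 - a) = 14 * rootRadius a := by unfold rootRadius; ring
  obtain ⟨ha0, ha1⟩ := ha
  set r := rootRadius a
  obtain ⟨x, rfl⟩ : ∃ x, u = w + x := ⟨u - w, by ring⟩
  obtain ⟨y, rfl⟩ : ∃ y, v = w + y := ⟨v - w, by ring⟩
  rw [add_sub_cancel_left] at hu hv
  have hexp : gQuot a (w + x) (w + y) =
      (-3 * w ^ 2 + 2 * (1 + a) * w - a) + ((1 + a - 3 * w) * (x + y) - (x ^ 2 + x * y + y ^ 2)) := by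
    unfold gQuot; ring
  have hw2 : |1 + a - 3 * w| ≤ 2 := by
    rcases hw with rfl | rfl | rfl <;> rw [abs_le] <;> constructor <;> linarith
  have hrem : |(1 + a - 3 * w) * (x + y) - (x ^ 2 + x * y + y ^ 2)| ≤ 7 * r := by
    have hxy : |x + y| ≤ 2 * r := (abs_add_le x y).trans (by linarith)
    have h1 : |(1 + a - 3 * w) * (x + y)| ≤ 2 * (2 * r) := by
      rw [abs_mul]
      exact mul_le_mul hw2 hxy (abs_nonneg _) (by norm_num)
    have h2 : |x ^ 2 + x * y + y ^ 2| ≤ 3 * r := by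
      rw [abs_le] at hu hv
      rw [abs_le]
      constructor <;> nlinarith [sq_nonneg (x + y), sq_nonneg (x - y)]
    calc _ ≤ _ := abs_sub _ _
      _ ≤ 7 * r := by linarith
  rw [abs_le] at hrem
  rw [hexp]
  by_cases hwa : w = a
  · subst hwa
    simp only [rootSign, if_true]
    constructor <;> nlinarith
  · simp only [rootSign, if_neg hwa]
    rcases hw with rfl | h | rfl
    · constructor <;> nlinarith
    · exact absurd h hwa
    · constructor <;> nlinarith

/-- Near a root of the uncoupled system the field is strongly monotone with respect to the
indefinite form given by the signs of the linearization. -/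
theorem mul_sum_sq_le_sum_rootSign_mul (ha : a ∈ Ioo (0 : ℝ) 1) (hd : 0 < d) {w u v : ZMod n → ℝ}
    (hw : ∀ i, w i = 0 ∨ w i = a ∨ w i = 1) (hu : ∀ i, |u i - w i| ≤ rootRadius a)
    (hv : ∀ i, |v i - w i| ≤ rootRadius a) :
    (7 * rootRadius a - 4 * d) * ∑ i, (u i - v i) ^ 2 ≤
      ∑ i, rootSign a (w i) * ((u i - v i) * (GF n a d u i - GF n a d v i)) := by
  have hl : ∑ i : ZMod n, (u (i - 1) - v (i - 1)) ^ 2 = ∑ i, (u i - v i) ^ 2 :=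
    Equiv.sum_comp (Equiv.subRight (1 : ZMod n)) fun i => (u i - v i) ^ 2
  have hr : ∑ i : ZMod n, (u (i + 1) - v (i + 1)) ^ 2 = ∑ i, (u i - v i) ^ 2 :=
    Equiv.sum_comp (Equiv.addRight (1 : ZMod n)) fun i => (u i - v i) ^ 2
  calc (7 * rootRadius a - 4 * d) * ∑ i, (u i - v i) ^ 2
      = ∑ i : ZMod n, ((7 * rootRadius a - 3 * d) * (u i - v i) ^ 2
          - d / 2 * (u (i - 1) - v (i - 1)) ^ 2 - d / 2 * (u (i + 1) - v (i + 1)) ^ 2) := by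
        rw [Finset.sum_sub_distrib, Finset.sum_sub_distrib, ← Finset.mul_sum, ← Finset.mul_sum,
          ← Finset.mul_sum, hl, hr]
        ring
    _ ≤ _ := Finset.sum_le_sum fun i _ => by
        have hq := (rootSign_mul_gQuot_mem ha (hw i) (hu i) (hv i)).1
        have hq' := mul_le_mul_of_nonneg_right hq (sq_nonneg (u i - v i))
        rw [GF_sub_GF]
        generalize u (i - 1) - v (i - 1) = y
        generalize u (i + 1) - v (i + 1) = z
        generalize u i - v i = x at hq' ⊢
        have key : ∀ s : ℝ, s = 1 ∨ s = -1 →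
            -(3 * x ^ 2 + y ^ 2 / 2 + z ^ 2 / 2) ≤ s * (x * (y - 2 * x + z)) := by
          rintro s (rfl | rfl)
          · nlinarith [sq_nonneg (x + y), sq_nonneg (x + z)]
          · nlinarith [sq_nonneg (x - y), sq_nonneg (x - z), sq_nonneg x]
        have hk := mul_le_mul_of_nonneg_left (key _ (rootSign_eq_or a (w i))) hd.le
        linarith

theorem GF_eq_zero_unique (ha : a ∈ Ioo (0 : ℝ) 1) (hd : 0 < d) (hdr : d ≤ rootRadius a)
    {w u v : ZMod n → ℝ} (hw : ∀ i, w i = 0 ∨ w i = a ∨ w i = 1)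
    (hu : ∀ i, |u i - w i| ≤ rootRadius a) (hv : ∀ i, |v i - w i| ≤ rootRadius a)
    (hu0 : ∀ i, GF n a d u i = 0) (hv0 : ∀ i, GF n a d v i = 0) : u = v := by
  have h := mul_sum_sq_le_sum_rootSign_mul ha hd hw hu hv
  simp only [hu0, hv0, sub_self, mul_zero, Finset.sum_const_zero] at h
  have hs : ∑ i, (u i - v i) ^ 2 = 0 :=
    le_antisymm (nonpos_of_mul_nonpos_right h (by linarith [rootRadius_pos ha]))
      (Finset.sum_nonneg fun i _ => sq_nonneg _)
  funext i
  have := (Finset.sum_eq_zero_iff_of_nonneg fun i _ => sq_nonneg _).mp hs i (Finset.mem_univ i)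
  exact sub_eq_zero.mp (pow_eq_zero_iff two_ne_zero |>.mp this)

theorem exists_GF_eq_zero (ha : a ∈ Ioo (0 : ℝ) 1) (hd : 0 < d)
    (hdr : 2 * d ≤ rootRadius a ^ 2) {w : ZMod n → ℝ} (hw : ∀ i, w i = 0 ∨ w i = a ∨ w i = 1) :
    ∃ v ∈ Metric.closedBall w (rootRadius a / 2), ∀ i, GF n a d v i = 0 := by
  have hpos := rootRadius_pos ha
  have hle := rootRadius_le a
  set r := rootRadius a
  let T : (ZMod n → ℝ) → ZMod n → ℝ := fun v i => v i - rootSign a (w i) / 2 * GF n a d v i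
  have hmem : ∀ v ∈ Metric.closedBall w (r / 2), ∀ i, |v i - w i| ≤ r := fun v hv i =>
    ((dist_le_pi_dist v w i).trans hv).trans (by linarith)
  have hT : ∀ u ∈ Metric.closedBall w (r / 2), ∀ v ∈ Metric.closedBall w (r / 2),
      dist (T u) (T v) ≤ (1 - 2 * r) * dist u v := by
    intro u hu v hv
    rw [dist_pi_le_iff (mul_nonneg (by linarith) dist_nonneg)]
    intro i
    have hq := rootSign_mul_gQuot_mem ha (hw i) (hmem u hu i) (hmem v hv i)
    have hT' : T u i - T v i = (1 - rootSign a (w i) * gQuot a (u i) (v i) / 2) * (u i - v i)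
        - rootSign a (w i) * (d / 2 * ((u (i - 1) - v (i - 1)) - 2 * (u i - v i)
          + (u (i + 1) - v (i + 1)))) := by
      have := GF_sub_GF (a := a) (d := d) u v i
      simp only [T]
      linear_combination -(rootSign a (w i) / 2) * this
    have hσ : |rootSign a (w i)| = 1 := by rcases rootSign_eq_or a (w i) with h | h <;> simp [h]
    have hD : ∀ j, |u j - v j| ≤ dist u v := fun j => dist_le_pi_dist u v j
    have hlap : |(u (i - 1) - v (i - 1)) - 2 * (u i - v i) + (u (i + 1) - v (i + 1))| ≤
        4 * dist u v := by
      have h1 := abs_le.mp (hD (i - 1))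
      have h2 := abs_le.mp (hD i)
      have h3 := abs_le.mp (hD (i + 1))
      rw [abs_le]
      constructor <;> linarith
    have hA : |1 - rootSign a (w i) * gQuot a (u i) (v i) / 2| ≤ 1 - 7 * r / 2 := by
      rw [abs_le]
      constructor <;> linarith [hq.1, hq.2]
    rw [Real.dist_eq, hT']
    calc _ ≤ |(1 - rootSign a (w i) * gQuot a (u i) (v i) / 2) * (u i - v i)| +
          |rootSign a (w i) * (d / 2 * ((u (i - 1) - v (i - 1)) - 2 * (u i - v i)
          + (u (i + 1) - v (i + 1))))| := abs_sub _ _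
      _ ≤ (1 - 7 * r / 2) * dist u v + d / 2 * (4 * dist u v) := by
        rw [abs_mul, abs_mul, abs_mul, hσ, one_mul, abs_of_pos (half_pos hd)]
        gcongr
        · linarith
        · exact hD i
      _ ≤ (1 - 2 * r) * dist u v := by
        nlinarith [mul_nonneg (by nlinarith : 0 ≤ 3 / 2 * r - 2 * d) (dist_nonneg (x := u) (y := v))]
  have hw0 : dist (T w) w ≤ 2 * d := by
    rw [dist_pi_le_iff (by linarith)]
    intro i
    have hb : ∀ j, 0 ≤ w j ∧ w j ≤ 1 := fun j => by
      rcases hw j with h | h | h <;> rw [h] <;> constructor <;> linarith [ha.1, ha.2]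
    have hg : g a (w i) = 0 := by rcases hw i with h | h | h <;> simp [g, h]
    have hlap : |w (i - 1) - 2 * w i + w (i + 1)| ≤ 2 := by
      rw [abs_le]
      constructor <;> linarith [hb i, hb (i - 1), hb (i + 1)]
    have hσ : |rootSign a (w i)| = 1 := by rcases rootSign_eq_or a (w i) with h | h <;> simp [h]
    simp only [T, GF, hg, add_zero, Real.dist_eq, sub_sub_cancel_left, abs_neg, abs_mul, abs_div,
      hσ, abs_of_pos hd]
    rw [abs_of_pos (by norm_num : (0 : ℝ) < 2)]
    nlinarith
  have hwmem : w ∈ Metric.closedBall w (r / 2) := Metric.mem_closedBall_self (by linarith)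
  have hmaps : MapsTo T (Metric.closedBall w (r / 2)) (Metric.closedBall w (r / 2)) := by
    intro v hv
    have h1 := hT v hv w hwmem
    have h2 := dist_triangle (T v) (T w) w
    have h3 : dist v w ≤ r / 2 := hv
    rw [Metric.mem_closedBall]
    nlinarith
  have hcontr : ContractingWith (1 - 2 * r).toNNReal (hmaps.restrict T _ _) := by
    refine ⟨Real.toNNReal_lt_one.mpr (by linarith), LipschitzWith.of_dist_le_mul fun u v => ?_⟩
    rw [Real.coe_toNNReal _ (by linarith)]
    exact hT u u.2 v v.2
  obtain ⟨v, hv, hfix, -⟩ := hcontr.exists_fixedPoint' Metric.isClosed_closedBall.isComplete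
    hmaps hwmem (edist_ne_top _ _)
  refine ⟨v, hv, fun i => ?_⟩
  have hi : v i - rootSign a (w i) / 2 * GF n a d v i = v i := congrFun hfix i
  rcases rootSign_eq_or a (w i) with h | h <;> rw [h] at hi <;> linarith

/-- Every stationary solution is close to a root of the uncoupled system. -/
theorem exists_root_near_of_GF_eq_zero (ha : a ∈ Ioo (0 : ℝ) 1) (hd : 0 < d)
    (hdr : 2 * d < rootRadius a ^ 3) {v : ZMod n → ℝ} (hv : ∀ i, GF n a d v i = 0) :
    ∃ w : ZMod n → ℝ, (∀ i, w i = 0 ∨ w i = a ∨ w i = 1) ∧ v ∈ Metric.ball w (rootRadius a) := by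
  have hpos := rootRadius_pos ha
  obtain ⟨ha0, ha1⟩ := ha
  set r := rootRadius a
  obtain ⟨j, hj⟩ := Finite.exists_max v
  obtain ⟨k, hk⟩ := Finite.exists_min v
  have hj1 : v j ≤ 1 := by
    by_contra! h
    have h0 := hv j
    have hg : g a (v j) < 0 := by
      unfold g
      exact mul_neg_of_neg_of_pos (mul_neg_of_pos_of_neg (by linarith) (by linarith))
        (by linarith)
    unfold GF at h0
    nlinarith [hj (j - 1), hj (j + 1)]
  have hk0 : 0 ≤ v k := by
    by_contra! h
    have h0 := hv k
    have hg : 0 < g a (v k) := by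
      unfold g
      exact mul_pos_of_neg_of_neg (mul_neg_of_neg_of_pos (by linarith) (by linarith))
        (by linarith)
    unfold GF at h0
    nlinarith [hk (k - 1), hk (k + 1)]
  have hb : ∀ i, 0 ≤ v i ∧ v i ≤ 1 := fun i => ⟨hk0.trans (hk i), (hj i).trans hj1⟩
  have hnear : ∀ i, ∃ w : ℝ, (w = 0 ∨ w = a ∨ w = 1) ∧ |v i - w| < r := by
    intro i
    by_contra! h
    have h1 := h 0 (by simp)
    have h2 := h a (by simp)
    have h3 := h 1 (by simp)
    rw [sub_zero] at h1
    rw [abs_sub_comm] at h3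
    have hg : r ^ 3 ≤ |g a (v i)| := by
      unfold g
      rw [abs_mul, abs_mul, show r ^ 3 = r * r * r by ring]
      gcongr
    have h0 := hv i
    unfold GF at h0
    have : |g a (v i)| ≤ 2 * d := by
      rw [abs_le]
      constructor <;> nlinarith [hb i, hb (i - 1), hb (i + 1)]
    linarith
  choose w hw hvw using hnear
  exact ⟨w, hw, (dist_pi_lt_iff hpos).mpr hvw⟩

theorem IsODESol.hasDerivAt_sum_sq {V : ℝ → ZMod n → ℝ} (hV : IsODESol n a d V) (c p : ZMod n → ℝ)
    {t : ℝ} (ht : 0 ≤ t) :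
    HasDerivAt (fun s => ∑ i, c i * (V s i - p i) ^ 2)
      (2 * ∑ i, c i * ((V t i - p i) * GF n a d (V t) i)) t := by
  rw [Finset.mul_sum]
  refine HasDerivAt.fun_sum fun i _ => ?_
  have h := (((hasDerivAt_pi.mp (hV t ht) i).sub_const (p i)).pow 2).const_mul (c i)
  refine h.congr_deriv ?_
  push_cast
  ring

theorem sum_sq_le_of_norm_le {n : ℕ} [NeZero n] {x : ZMod n → ℝ} {r : ℝ} (h : ‖x‖ ≤ r) :
    ∑ i, x i ^ 2 ≤ n * r ^ 2 := by
  calc ∑ i, x i ^ 2 ≤ ∑ _i : ZMod n, r ^ 2 := Finset.sum_le_sum fun i _ =>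
        sq_le_sq' (abs_le.mp ((norm_le_pi_norm x i).trans h)).1
          (abs_le.mp ((norm_le_pi_norm x i).trans h)).2
    _ = n * r ^ 2 := by simp [ZMod.card]

theorem abs_sub_le_of_norm_sub_le {w v u : ZMod n → ℝ} {r : ℝ}
    (h : ‖u - v‖ ≤ r - dist v w) (i : ZMod n) : |u i - w i| ≤ r := by
  have h1 := dist_le_pi_dist u w i
  rw [Real.dist_eq] at h1
  have h2 := dist_triangle u v w
  rw [dist_eq_norm u v] at h2
  linarith

/-- Exponential decay towards an equilibrium near a root in `{0, 1}ⁿ`. -/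
theorem IsODESol.norm_sub_le_mul_exp (ha : a ∈ Ioo (0 : ℝ) 1) (hd : 0 < d)
    (hdr : d ≤ rootRadius a) {w v : ZMod n → ℝ} (hw : ∀ i, w i = 0 ∨ w i = 1)
    (hv : ∀ i, GF n a d v i = 0) {η : ℝ} (hη : 0 < η) (hηr : η ≤ rootRadius a - dist v w)
    {V : ℝ → ZMod n → ℝ} (hV : IsODESol n a d V) (hV0 : ‖V 0 - v‖ ≤ η / n) {t : ℝ} (ht : 0 ≤ t) :
    ‖V t - v‖ ≤ η * Real.exp (-((7 * rootRadius a - 4 * d) / 2) * t) := by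
  have hκ : 0 < 7 * rootRadius a - 4 * d := by linarith [rootRadius_pos ha]
  set κ := 7 * rootRadius a - 4 * d with hκdef
  have hσ : ∀ i, rootSign a (w i) = -1 := fun i => if_neg <| by
    rcases hw i with h | h <;> rw [h]
    exacts [ha.1.ne, ha.2.ne']
  have hn : (1 : ℝ) ≤ n := by exact_mod_cast Nat.one_le_iff_ne_zero.mpr (NeZero.ne n)
  have hderiv : ∀ s, 0 ≤ s → HasDerivAt (fun s => ∑ i, (V s i - v i) ^ 2)
      (2 * ∑ i, (V s i - v i) * GF n a d (V s) i) s := fun s hs => by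
    simpa using hV.hasDerivAt_sum_sq (fun _ => 1) v hs
  have hB : ∀ s, HasDerivAt (fun s => η ^ 2 * Real.exp (-κ * s))
      (η ^ 2 * (Real.exp (-κ * s) * (-κ))) s := fun s => by
    simpa using (((hasDerivAt_id s).const_mul (-κ)).exp).const_mul (η ^ 2)
  have hle := image_le_of_deriv_right_lt_deriv_boundary (a := 0) (b := t)
    (fun s hs => (hderiv s hs.1).continuousAt.continuousWithinAt)
    (fun s hs => (hderiv s hs.1).hasDerivWithinAt)
    (by
      have h := sum_sq_le_of_norm_le hV0
      have h2 : (n : ℝ) * (η / n) ^ 2 ≤ η ^ 2 := by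
        have : (n : ℝ) * (η / n) ^ 2 = η ^ 2 / n := by field_simp
        rw [this]
        exact div_le_self (sq_nonneg _) hn
      simpa using h.trans h2) hB
    (fun s hs heq => by
      have hpos : 0 < η ^ 2 * Real.exp (-κ * s) := by positivity
      have hexp : Real.exp (-κ * s) ≤ 1 := Real.exp_le_one_iff.mpr (by nlinarith [hs.1])
      have hnorm : ‖V s - v‖ ≤ η := by
        refine (pi_norm_le_iff_of_nonneg hη.le).mpr fun i => abs_le_of_sq_le_sq ?_ hη.le
        calc (V s i - v i) ^ 2 ≤ ∑ i, (V s i - v i) ^ 2 :=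
              Finset.single_le_sum (f := fun i => (V s i - v i) ^ 2)
                (fun i _ => sq_nonneg _) (Finset.mem_univ i)
          _ ≤ η ^ 2 := by rw [heq]; exact mul_le_of_le_one_right (sq_nonneg _) hexp
      have hmono := mul_sum_sq_le_sum_rootSign_mul ha hd (fun i => (hw i).imp_right Or.inr)
        (abs_sub_le_of_norm_sub_le (hnorm.trans hηr))
        (abs_sub_le_of_norm_sub_le (u := v) (by rw [sub_self, norm_zero]; linarith))
      simp only [hσ, hv, sub_zero, neg_one_mul, Finset.sum_neg_distrib] at hmono
      rw [heq, ← hκdef] at hmono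
      nlinarith)
    (right_mem_Icc.mpr ht)
  have hsq : (η * Real.exp (-(κ / 2) * t)) ^ 2 = η ^ 2 * Real.exp (-κ * t) := by
    rw [mul_pow, ← Real.exp_nat_mul]
    congr 2
    push_cast
    ring
  refine (pi_norm_le_iff_of_nonneg (by positivity)).mpr fun i =>
    abs_le_of_sq_le_sq ?_ (by positivity)
  rw [hsq]
  exact (Finset.single_le_sum (f := fun i => (V t i - v i) ^ 2)
    (fun i _ => sq_nonneg _) (Finset.mem_univ i)).trans hle

theorem odeAsympStable_of_near_zero_one (ha : a ∈ Ioo (0 : ℝ) 1) (hd : 0 < d)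
    (hdr : d ≤ rootRadius a) {w v : ZMod n → ℝ} (hw : ∀ i, w i = 0 ∨ w i = 1)
    (hvw : v ∈ Metric.ball w (rootRadius a)) (hv : ∀ i, GF n a d v i = 0) :
    ODEAsympStable n a d v := by
  have hρ : 0 < rootRadius a - dist v w := sub_pos.mpr hvw
  have hκ : 0 < (7 * rootRadius a - 4 * d) / 2 := by linarith [rootRadius_pos ha]
  have hn : (0 : ℝ) < n := by exact_mod_cast Nat.pos_of_ne_zero (NeZero.ne n)
  constructor
  · intro ε hε
    have hη : 0 < min (ε / 2) (rootRadius a - dist v w) := lt_min (half_pos hε) hρ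
    refine ⟨_, div_pos hη hn, fun V hV hV0 t ht => ?_⟩
    have h := hV.norm_sub_le_mul_exp ha hd hdr hw hv hη (min_le_right _ _) hV0.le ht
    have hexp : Real.exp (-((7 * rootRadius a - 4 * d) / 2) * t) ≤ 1 :=
      Real.exp_le_one_iff.mpr (by nlinarith)
    calc _ ≤ _ := h
      _ ≤ min (ε / 2) (rootRadius a - dist v w) := mul_le_of_le_one_right hη.le hexp
      _ ≤ ε / 2 := min_le_left _ _
      _ < ε := half_lt_self hε
  · refine ⟨_, div_pos hρ hn, fun V hV hV0 => ?_⟩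
    rw [tendsto_iff_norm_sub_tendsto_zero]
    have hlim : Tendsto (fun t : ℝ => (rootRadius a - dist v w) *
        Real.exp (-((7 * rootRadius a - 4 * d) / 2) * t)) atTop (nhds 0) := by
      have h1 : Tendsto (fun t : ℝ => -((7 * rootRadius a - 4 * d) / 2) * t) atTop atBot :=
        tendsto_id.const_mul_atTop_of_neg (neg_lt_zero.mpr hκ)
      simpa using (Real.tendsto_exp_atBot.comp h1).const_mul (rootRadius a - dist v w)
    refine squeeze_zero' (Eventually.of_forall fun _ => norm_nonneg _) ?_ hlim
    filter_upwards [eventually_ge_atTop 0] with t ht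
    exact hV.norm_sub_le_mul_exp ha hd hdr hw hv hρ le_rfl hV0.le ht

theorem not_odeAsympStable_of_near_root (ha : a ∈ Ioo (0 : ℝ) 1) (hd : 0 < d)
    (hdr : d ≤ rootRadius a) {w v : ZMod n → ℝ} (hw : ∀ i, w i = 0 ∨ w i = a ∨ w i = 1)
    (hwa : ∃ i, w i = a) (hvw : v ∈ Metric.ball w (rootRadius a))
    (hv : ∀ i, GF n a d v i = 0) : ¬ ODEAsympStable n a d v := by
  rintro ⟨hstab, -⟩
  obtain ⟨i₀, hi₀⟩ := hwa
  have hρ : 0 < rootRadius a - dist v w := sub_pos.mpr hvw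
  have hκ : 0 < 7 * rootRadius a - 4 * d := by linarith [rootRadius_pos ha]
  set κ := 7 * rootRadius a - 4 * d with hκdef
  obtain ⟨δ, hδ, hstab⟩ := hstab _ hρ
  obtain ⟨s, hs, hsδ, hs1⟩ : ∃ s : ℝ, 0 < s ∧ s < δ ∧ s ≤ 1 / 2 :=
    ⟨min (δ / 2) (1 / 2), lt_min (half_pos hδ) (by norm_num),
      (min_le_left _ _).trans_lt (half_lt_self hδ), min_le_right _ _⟩
  have hx₀ : ∀ i, (v + Pi.single i₀ s : ZMod n → ℝ) i ∈ Icc (-1 : ℝ) 2 := by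
    intro i
    have hvi := abs_le.mp ((dist_le_pi_dist v w i).trans hvw.le)
    have hr := rootRadius_le a
    have hwi : 0 ≤ w i ∧ w i ≤ 1 := by
      rcases hw i with h | h | h <;> rw [h] <;> constructor <;> linarith [ha.1, ha.2]
    have hsi : 0 ≤ (Pi.single i₀ s : ZMod n → ℝ) i ∧ (Pi.single i₀ s : ZMod n → ℝ) i ≤ 1 / 2 := by
      rw [Pi.single_apply]
      split_ifs <;> constructor <;> linarith
    rw [Pi.add_apply]
    constructor <;> linarith [hvi.1, hvi.2, hwi.1, hwi.2, hsi.1, hsi.2]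
  obtain ⟨V, hV, hV0⟩ := exists_isODESol ha hd hx₀
  have hstay := hstab V hV (by
    rw [hV0, add_sub_cancel_left, Pi.norm_single, Real.norm_eq_abs, abs_of_pos hs]
    exact hsδ)
  have hσle : ∀ u : ZMod n → ℝ, ∑ i, rootSign a (w i) * (u i - v i) ^ 2 ≤ ∑ i, (u i - v i) ^ 2 :=
    fun u => Finset.sum_le_sum fun i _ => by
      rcases rootSign_eq_or a (w i) with h | h <;> rw [h] <;> nlinarith [sq_nonneg (u i - v i)]
  have hgrow : ∀ t, 0 ≤ t →
      s ^ 2 + κ * s ^ 2 * t ≤ ∑ i, rootSign a (w i) * (V t i - v i) ^ 2 := by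
    intro t ht
    have hB : ∀ x : ℝ, HasDerivAt (fun x => -(s ^ 2 + κ * s ^ 2 * x)) (-(κ * s ^ 2)) x :=
      fun x => by
        simpa using (((hasDerivAt_id x).const_mul (κ * s ^ 2)).const_add (s ^ 2)).fun_neg
    have h := image_le_of_deriv_right_lt_deriv_boundary (a := 0) (b := t)
      (f := fun x => -∑ i, rootSign a (w i) * (V x i - v i) ^ 2)
      (fun x hx => (hV.hasDerivAt_sum_sq (fun i => rootSign a (w i)) v
        hx.1).fun_neg.continuousAt.continuousWithinAt)
      (fun x hx => (hV.hasDerivAt_sum_sq (fun i => rootSign a (w i)) v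
        hx.1).fun_neg.hasDerivWithinAt)
      (by
        rw [hV0, Finset.sum_eq_single i₀]
        · simp [rootSign, hi₀]
        · intro i _ hi
          simp [hi]
        · simp) hB
      (fun x hx heq => by
        have hmono := mul_sum_sq_le_sum_rootSign_mul ha hd hw
          (abs_sub_le_of_norm_sub_le (hstay x hx.1).le)
          (abs_sub_le_of_norm_sub_le (u := v) (by rw [sub_self, norm_zero]; linarith))
        simp only [hv, sub_zero] at hmono
        have h1 := hσle (V x)
        have h2 : 0 ≤ κ * s ^ 2 * x := mul_nonneg (by positivity) hx.1
        have h3 : s ^ 2 ≤ ∑ i, (V x i - v i) ^ 2 := by linarith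
        have h4 := mul_le_mul_of_nonneg_left h3 hκ.le
        have h5 : 0 < κ * s ^ 2 := by positivity
        linarith)
      (right_mem_Icc.mpr ht)
    linarith
  have hκs : 0 < κ * s ^ 2 := by positivity
  have hT : 0 ≤ n * (rootRadius a - dist v w) ^ 2 / (κ * s ^ 2) := by positivity
  have h1 := hgrow _ hT
  rw [mul_div_cancel₀ _ hκs.ne'] at h1
  have h2 := hσle (V (n * (rootRadius a - dist v w) ^ 2 / (κ * s ^ 2)))
  have h3 := sum_sq_le_of_norm_le (hstay _ hT).le
  simp only [Pi.sub_apply] at h3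
  have : 0 < s ^ 2 := by positivity
  linarith

end StationarySolutions

/-- For all small `d > 0` the cyclic Nagumo system has exactly one solution near each of
the `3ⁿ` roots in `{0, a, 1}ⁿ`; the solutions near the `2ⁿ` roots in `{0,1}ⁿ` are
asymptotically stable, those near roots containing an entry `a` are not, and exactly
`2ⁿ` stationary solutions are asymptotically stable. -/
theorem card_stable_stationary_solutions
    (n : ℕ) [NeZero n] (hn : 3 ≤ n) (a : ℝ) (ha : a ∈ Set.Ioo (0:ℝ) 1) :
    ∃ d0 > (0:ℝ), ∃ ε > (0:ℝ), ∀ d ∈ Set.Ioo (0:ℝ) d0,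
      (∀ w : ZMod n → ℝ, (∀ i, w i = 0 ∨ w i = a ∨ w i = 1) →
        ∃! v : ZMod n → ℝ, v ∈ Metric.ball w ε ∧ ∀ i : ZMod n, GF n a d v i = 0) ∧
      (∀ w : ZMod n → ℝ, (∀ i, w i = 0 ∨ w i = 1) →
        ∀ v : ZMod n → ℝ, v ∈ Metric.ball w ε → (∀ i : ZMod n, GF n a d v i = 0) →
          ODEAsympStable n a d v) ∧
      (∀ w : ZMod n → ℝ, (∀ i, w i = 0 ∨ w i = a ∨ w i = 1) → (∃ i, w i = a) →
        ∀ v : ZMod n → ℝ, v ∈ Metric.ball w ε → (∀ i : ZMod n, GF n a d v i = 0) →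
          ¬ ODEAsympStable n a d v) ∧
      {v : ZMod n → ℝ | (∀ i : ZMod n, GF n a d v i = 0) ∧
        ODEAsympStable n a d v}.ncard = 2 ^ n := by
  have hpos := rootRadius_pos ha
  have hle := rootRadius_le a
  refine ⟨rootRadius a ^ 3 / 2, by positivity, rootRadius a, hpos, fun d hd => ?_⟩
  obtain ⟨hd0, hd1⟩ := hd
  have hd3 : 2 * d < rootRadius a ^ 3 := by linarith
  have hd2 : 2 * d ≤ rootRadius a ^ 2 := by nlinarith [sq_nonneg (rootRadius a)]
  have hdr : d ≤ rootRadius a := by nlinarith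
  have hball : ∀ {u w : ZMod n → ℝ}, u ∈ Metric.ball w (rootRadius a) →
      ∀ i, |u i - w i| ≤ rootRadius a := fun hu i => (dist_le_pi_dist _ _ i).trans hu.le
  have hex : ∀ w : ZMod n → ℝ, (∀ i, w i = 0 ∨ w i = a ∨ w i = 1) →
      ∃ v ∈ Metric.ball w (rootRadius a), ∀ i, GF n a d v i = 0 := fun w hw =>
    let ⟨v, hv, hv0⟩ := exists_GF_eq_zero ha hd0 hd2 hw
    ⟨v, Metric.closedBall_subset_ball (half_lt_self hpos) hv, hv0⟩
  refine ⟨fun w hw => ?_, fun w hw v => odeAsympStable_of_near_zero_one ha hd0 hdr hw,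
    fun w hw hwa v => not_odeAsympStable_of_near_root ha hd0 hdr hw hwa, ?_⟩
  · obtain ⟨v, hv, hv0⟩ := hex w hw
    exact ⟨v, ⟨hv, hv0⟩, fun u hu =>
      GF_eq_zero_unique ha hd0 hdr hw (hball hu.1) (hball hv) hu.2 hv0⟩
  · let w : (ZMod n → Bool) → ZMod n → ℝ := fun b i => if b i then 1 else 0
    have hw : ∀ b i, w b i = 0 ∨ w b i = 1 := fun b i => by
      by_cases h : b i <;> simp [w, h]
    have hw' : ∀ b i, w b i = 0 ∨ w b i = a ∨ w b i = 1 := fun b i => (hw b i).imp_right Or.inr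
    choose F hF hF0 using fun b => hex (w b) (hw' b)
    have hinj : Function.Injective F := by
      intro b c hbc
      funext i
      have hb := abs_le.mp (hball (hF b) i)
      have hc := abs_le.mp (hball (hF c) i)
      rw [hbc] at hb
      by_contra hne
      rcases hbi : b i <;> rcases hci : c i <;> simp only [w, hbi, hci] at hb hc
      · exact hne (hbi.trans hci.symm)
      · norm_num at hb hc; linarith
      · norm_num at hb hc; linarith
      · exact hne (hbi.trans hci.symm)
    have hset : {v : ZMod n → ℝ | (∀ i : ZMod n, GF n a d v i = 0) ∧ ODEAsympStable n a d v} =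
        F '' Set.univ := by
      ext v
      constructor
      · rintro ⟨hv0, hvs⟩
        obtain ⟨z, hz, hvz⟩ := exists_root_near_of_GF_eq_zero ha hd0 hd3 hv0
        have hza : ∀ i, z i ≠ a := fun i hi =>
          not_odeAsympStable_of_near_root ha hd0 hdr hz ⟨i, hi⟩ hvz hv0 hvs
        have hzw : z = w (fun i => decide (z i = 1)) := by
          funext i
          rcases hz i with h | h | h
          · simp [w, h]
          · exact absurd h (hza i)
          · simp [w, h]
        refine ⟨fun i => decide (z i = 1), Set.mem_univ _, ?_⟩
        refine GF_eq_zero_unique ha hd0 hdr (hw' _) (hball (hF _)) (hball ?_) (hF0 _) hv0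
        rwa [← hzw]
      · rintro ⟨b, -, rfl⟩
        exact ⟨hF0 b, odeAsympStable_of_near_zero_one ha hd0 hdr (hw b) (hF b) (hF0 b)⟩
    rw [hset, Set.ncard_image_of_injective _ hinj, Set.ncard_univ, Nat.card_eq_fintype_card]
    simp [ZMod.card]
end

section
/- Fix $n \ge 3$ and $a \in (0,1)$. Let $\mathrm{w}_A, \mathrm{w}_B \in \{0, a, 1\}^n$ be distinct vectors with $(\mathrm{w}_A)_i \le (\mathrm{w}_B)_i$ for all $i$, and suppose at least one of them lies in $\{0,1\}^n$. Then there exist $d_0 > 0$ and $\varepsilon > 0$ such that for every $d \in (0, d_0)$, the unique solutions $\mathrm{u}_A(d)$ and $\mathrm{u}_B(d)$ of the cyclic system $d(\mathrm{u}_{i-1} - 2\mathrm{u}_i + \mathrm{u}_{i+1}) + g(\mathrm{u}_i;a) = 0$ (indices mod $n$) lying in the $\varepsilon$-balls around $\mathrm{w}_A$ and $\mathrm{w}_B$ respectively satisfy the strict componentwise inequality $(\mathrm{u}_A(d))_i < (\mathrm{u}_B(d))_i$ for all $i \in \{1, \ldots, n\}$. -/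
/-- The difference quotient of the cubic `g a`; on the diagonal it is the derivative. -/
noncomputable def gSlope (a x y : ℝ) : ℝ := (1 + a) * (x + y) - (x ^ 2 + x * y + y ^ 2) - a

lemma g_sub_g_s7 (a x y : ℝ) : g a x - g a y = gSlope a x y * (x - y) := by
  unfold g gSlope; ring

lemma abs_gSlope_sub_le {a w x y ε : ℝ} (ha : a ∈ Set.Ioo (0 : ℝ) 1)
    (hw : w = 0 ∨ w = a ∨ w = 1) (hε : ε ≤ 1) (hx : |x - w| ≤ ε) (hy : |y - w| ≤ ε) :
    |gSlope a x y - gSlope a w w| ≤ 9 * ε := by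
  obtain ⟨ha0, ha1⟩ := ha
  have hε0 : 0 ≤ ε := (abs_nonneg _).trans hx
  have hid : gSlope a x y - gSlope a w w = (1 + a - 3 * w) * ((x - w) + (y - w))
      - ((x - w) * (x - w) + (x - w) * (y - w) + (y - w) * (y - w)) := by
    unfold gSlope; ring
  have hc : |1 + a - 3 * w| ≤ 3 := by
    rw [abs_le]
    rcases hw with rfl | rfl | rfl <;> constructor <;> linarith
  have hprod : ∀ p r : ℝ, |p| ≤ ε → |r| ≤ ε → |p * r| ≤ ε := fun p r hp hr => by
    rw [abs_mul]
    nlinarith [abs_nonneg p, abs_nonneg r]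
  have hsum : |(x - w) + (y - w)| ≤ 2 * ε := (abs_add_le _ _).trans (by linarith)
  have hlin : |(1 + a - 3 * w) * ((x - w) + (y - w))| ≤ 3 * (2 * ε) := by
    rw [abs_mul]
    exact mul_le_mul hc hsum (abs_nonneg _) (by norm_num)
  have h1 := hprod _ _ hx hx
  have h2 := hprod _ _ hx hy
  have h3 := hprod _ _ hy hy
  rw [hid]
  rw [abs_le] at *
  constructor <;> linarith [h1.1, h1.2, h2.1, h2.2, h3.1, h3.2, hlin.1, hlin.2]

lemma le_abs_gSlope_self {a w : ℝ} (ha : a ∈ Set.Ioo (0 : ℝ) 1)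
    (hw : w = 0 ∨ w = a ∨ w = 1) : a * (1 - a) ≤ |gSlope a w w| := by
  obtain ⟨ha0, ha1⟩ := ha
  unfold gSlope
  rcases hw with rfl | rfl | rfl
  · exact le_abs.2 (Or.inr (by nlinarith))
  · exact le_abs.2 (Or.inl (by nlinarith))
  · exact le_abs.2 (Or.inr (by nlinarith))

lemma gSlope_self_le_neg {a w : ℝ} (ha : a ∈ Set.Ioo (0 : ℝ) 1)
    (hw : w = 0 ∨ w = 1) : gSlope a w w ≤ -(a * (1 - a)) := by
  obtain ⟨ha0, ha1⟩ := ha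
  unfold gSlope
  rcases hw with rfl | rfl <;> nlinarith

/-- The simplified Newton map for `GF n a d`, linearized at `w` for `d = 0`. -/
noncomputable def newtonMap (n : ℕ) (a d : ℝ) (w u : ZMod n → ℝ) : ZMod n → ℝ :=
  fun i => u i - GF n a d u i / gSlope a (w i) (w i)

section

variable {n : ℕ} {a d ε : ℝ} {w : ZMod n → ℝ}

lemma newtonMap_eq_self_iff (ha : a ∈ Set.Ioo (0 : ℝ) 1)
    (hw : ∀ i, w i = 0 ∨ w i = a ∨ w i = 1) (u : ZMod n → ℝ) :
    newtonMap n a d w u = u ↔ ∀ i, GF n a d u i = 0 := by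
  have hs : ∀ i, gSlope a (w i) (w i) ≠ 0 := fun i =>
    abs_pos.1 ((mul_pos ha.1 (sub_pos.2 ha.2)).trans_le (le_abs_gSlope_self ha (hw i)))
  simp [funext_iff, newtonMap, hs]

lemma dist_newtonMap_le [NeZero n] (ha : a ∈ Set.Ioo (0 : ℝ) 1)
    (hw : ∀ i, w i = 0 ∨ w i = a ∨ w i = 1) (hε : ε ≤ 1) (hεa : 36 * ε ≤ a * (1 - a))
    (hd0 : 0 ≤ d) (hd : 16 * d ≤ a * (1 - a)) {u v : ZMod n → ℝ}
    (hu : u ∈ Metric.closedBall w ε) (hv : v ∈ Metric.closedBall w ε) :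
    dist (newtonMap n a d w u) (newtonMap n a d w v) ≤ 1 / 2 * dist u v := by
  have hm : 0 < a * (1 - a) := mul_pos ha.1 (sub_pos.2 ha.2)
  have hD : ∀ j, |u j - v j| ≤ dist u v := fun j => by
    simpa [Real.dist_eq] using dist_le_pi_dist u v j
  have hD0 : 0 ≤ dist u v := dist_nonneg
  refine (dist_pi_le_iff (by positivity)).2 fun i => ?_
  have hui : |u i - w i| ≤ ε := by
    simpa [Real.dist_eq] using (dist_le_pi_dist u w i).trans hu
  have hvi : |v i - w i| ≤ ε := by
    simpa [Real.dist_eq] using (dist_le_pi_dist v w i).trans hv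
  have hq := abs_gSlope_sub_le ha (hw i) hε hui hvi
  have hs := le_abs_gSlope_self ha (hw i)
  set s := gSlope a (w i) (w i) with hsdef
  set q := gSlope a (u i) (v i) with hqdef
  have hs0 : s ≠ 0 := abs_pos.1 (hm.trans_le hs)
  set L := (u (i - 1) - v (i - 1)) - 2 * (u i - v i) + (u (i + 1) - v (i + 1)) with hL
  have hLD : |L| ≤ 4 * dist u v := by
    have h1 := abs_le.1 (hD (i - 1))
    have h2 := abs_le.1 (hD i)
    have h3 := abs_le.1 (hD (i + 1))
    rw [abs_le]
    constructor <;> linarith [h1.1, h1.2, h2.1, h2.2, h3.1, h3.2]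
  have hid : newtonMap n a d w u i - newtonMap n a d w v i
      = -((q - s) * (u i - v i) + d * L) / s := by
    have hg := g_sub_g_s7 a (u i) (v i)
    simp only [newtonMap, GF, ← hsdef]
    field_simp
    linear_combination -hg
  rw [Real.dist_eq, hid, abs_div, abs_neg, div_le_iff₀ (abs_pos.2 hs0)]
  calc |(q - s) * (u i - v i) + d * L|
      ≤ |q - s| * |u i - v i| + d * |L| := by
        refine (abs_add_le _ _).trans ?_
        rw [abs_mul, abs_mul, abs_of_nonneg hd0]
    _ ≤ (a * (1 - a) / 4) * dist u v + d * (4 * dist u v) := by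
        gcongr
        · linarith
        · exact hD i
    _ ≤ 1 / 2 * dist u v * (a * (1 - a)) := by nlinarith
    _ ≤ 1 / 2 * dist u v * |s| := by gcongr

lemma dist_newtonMap_self_le [NeZero n] (ha : a ∈ Set.Ioo (0 : ℝ) 1)
    (hw : ∀ i, w i = 0 ∨ w i = a ∨ w i = 1) (hd0 : 0 ≤ d) (hε0 : 0 ≤ ε)
    (hd : 16 * d ≤ ε * (a * (1 - a))) :
    dist (newtonMap n a d w w) w ≤ ε / 4 := by
  have hm : 0 < a * (1 - a) := mul_pos ha.1 (sub_pos.2 ha.2)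
  have hw01 : ∀ i, 0 ≤ w i ∧ w i ≤ 1 := fun i => by
    rcases hw i with h | h | h <;> rw [h] <;> constructor <;> linarith [ha.1, ha.2]
  refine (dist_pi_le_iff (by positivity)).2 fun i => ?_
  have hs := le_abs_gSlope_self ha (hw i)
  have hs0 : 0 < |gSlope a (w i) (w i)| := hm.trans_le hs
  have hg : g a (w i) = 0 := by
    rcases hw i with h | h | h <;> simp [g, h]
  have hL : |w (i - 1) - 2 * w i + w (i + 1)| ≤ 4 := by
    have h1 := hw01 (i - 1)
    have h2 := hw01 i
    have h3 := hw01 (i + 1)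
    rw [abs_le]
    constructor <;> linarith [h1.1, h1.2, h2.1, h2.2, h3.1, h3.2]
  rw [Real.dist_eq]
  simp only [newtonMap, GF, hg, add_zero, sub_sub_cancel_left, abs_neg]
  rw [abs_div, abs_mul, abs_of_nonneg hd0, div_le_iff₀ hs0]
  calc d * |w (i - 1) - 2 * w i + w (i + 1)| ≤ d * 4 := by gcongr
    _ ≤ ε / 4 * (a * (1 - a)) := by linarith
    _ ≤ ε / 4 * |gSlope a (w i) (w i)| := by gcongr

lemma existsUnique_stationary_near [NeZero n] (ha : a ∈ Set.Ioo (0 : ℝ) 1)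
    (hw : ∀ i, w i = 0 ∨ w i = a ∨ w i = 1) (hε0 : 0 < ε) (hε : ε ≤ 1)
    (hεa : 36 * ε ≤ a * (1 - a)) (hd0 : 0 ≤ d) (hd : 16 * d ≤ ε * (a * (1 - a))) :
    ∃! u : ZMod n → ℝ, u ∈ Metric.ball w ε ∧ ∀ i, GF n a d u i = 0 := by
  have hm : 0 < a * (1 - a) := mul_pos ha.1 (sub_pos.2 ha.2)
  have hd' : 16 * d ≤ a * (1 - a) := hd.trans (by nlinarith)
  have hlip : ∀ {u v}, u ∈ Metric.closedBall w ε → v ∈ Metric.closedBall w ε →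
      dist (newtonMap n a d w u) (newtonMap n a d w v) ≤ 1 / 2 * dist u v :=
    fun hu hv => dist_newtonMap_le ha hw hε hεa hd0 hd' hu hv
  have hsub : Metric.closedBall w (ε / 2) ⊆ Metric.closedBall w ε :=
    Metric.closedBall_subset_closedBall (by linarith)
  have hmaps : Set.MapsTo (newtonMap n a d w) (Metric.closedBall w (ε / 2))
      (Metric.closedBall w (ε / 2)) := fun u hu => by
    have h1 := hlip (hsub hu) (Metric.mem_closedBall_self hε0.le)
    have h2 := dist_newtonMap_self_le ha hw hd0 hε0.le hd
    have h3 := dist_triangle (newtonMap n a d w u) (newtonMap n a d w w) w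
    rw [Metric.mem_closedBall] at hu ⊢
    linarith
  have hcontr : ContractingWith (1 / 2) (hmaps.restrict _ _ _) :=
    ⟨by rw [← NNReal.coe_lt_coe]; norm_num, LipschitzWith.of_dist_le_mul fun u v => by
      simpa [Subtype.dist_eq] using hlip (hsub u.2) (hsub v.2)⟩
  obtain ⟨u, hu, hfix, -⟩ := hcontr.exists_fixedPoint' Metric.isClosed_closedBall.isComplete hmaps
    (Metric.mem_closedBall_self (by positivity : 0 ≤ ε / 2)) (edist_ne_top _ _)
  refine ⟨u, ⟨Metric.closedBall_subset_ball (by linarith) hu,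
    (newtonMap_eq_self_iff ha hw u).1 hfix⟩, fun v ⟨hv, hv0⟩ => ?_⟩
  have h := hlip (Metric.ball_subset_closedBall hv) (hsub hu)
  rw [(newtonMap_eq_self_iff ha hw v).2 hv0, hfix] at h
  exact dist_le_zero.1 (by linarith)

end

/-- Strong maximum principle on the cycle: a function that is strictly positive somewhere and
satisfies the discrete elliptic equation wherever it is nonpositive is strictly positive. -/
lemma pos_of_discrete_elliptic {n : ℕ} [NeZero n] {d : ℝ} (hd : 0 < d) {v c : ZMod n → ℝ}
    (hc : ∀ i, v i ≤ 0 → c i < 0)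
    (hv : ∀ i, v i ≤ 0 → d * (v (i - 1) - 2 * v i + v (i + 1)) + c i * v i = 0)
    (hpos : ∃ j, 0 < v j) (i : ZMod n) : 0 < v i := by
  obtain ⟨k, hk⟩ := Finite.exists_min v
  refine lt_of_lt_of_le ?_ (hk i)
  by_contra! hk0
  have hmin : ∀ i, v i ≤ 0 → (∀ j, v i ≤ v j) → v i = 0 ∧ v (i + 1) = 0 := fun i hi0 hi => by
    have hvi : v i = 0 := by nlinarith [hc i hi0, hv i hi0, hi (i - 1), hi (i + 1)]
    have heq := hv i hi0
    have h1 := hi (i - 1)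
    have h2 := hi (i + 1)
    rw [hvi] at heq h1 h2
    refine ⟨hvi, le_antisymm ?_ h2⟩
    nlinarith
  have hvk : v k = 0 := (hmin k hk0 hk).1
  have hall : ∀ m : ℕ, v (k + m) = 0 := fun m => by
    induction m with
    | zero => simpa using hvk
    | succ m ih =>
      have := (hmin (k + m) ih.le fun j => by rw [ih, ← hvk]; exact hk j).2
      simpa [add_assoc] using this
  obtain ⟨j, hj⟩ := hpos
  have := hall (j - k).val
  rw [ZMod.natCast_zmod_val, add_sub_cancel] at this
  exact hj.ne' this

/-- Ordering of branches: if `w_A ≤ w_B` are distinct words in `{0,a,1}ⁿ`, at least one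
of which lies in `{0,1}ⁿ`, then for small `d > 0` the corresponding unique stationary
solutions near `w_A` and `w_B` satisfy the strict componentwise inequality. -/
theorem branch_ordering
    (n : ℕ) [NeZero n] (hn : 3 ≤ n) (a : ℝ) (ha : a ∈ Set.Ioo (0:ℝ) 1)
    (wA wB : ZMod n → ℝ)
    (hA : ∀ i, wA i = 0 ∨ wA i = a ∨ wA i = 1)
    (hB : ∀ i, wB i = 0 ∨ wB i = a ∨ wB i = 1)
    (hne : wA ≠ wB) (hle : ∀ i, wA i ≤ wB i)
    (hbin : (∀ i, wA i = 0 ∨ wA i = 1) ∨ (∀ i, wB i = 0 ∨ wB i = 1)) :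
    ∃ d0 > (0:ℝ), ∃ ε > (0:ℝ), ∀ d ∈ Set.Ioo (0:ℝ) d0,
      (∃! uA : ZMod n → ℝ, uA ∈ Metric.ball wA ε ∧ ∀ i : ZMod n, GF n a d uA i = 0) ∧
      (∃! uB : ZMod n → ℝ, uB ∈ Metric.ball wB ε ∧ ∀ i : ZMod n, GF n a d uB i = 0) ∧
      ∀ uA uB : ZMod n → ℝ,
        uA ∈ Metric.ball wA ε → (∀ i : ZMod n, GF n a d uA i = 0) →
        uB ∈ Metric.ball wB ε → (∀ i : ZMod n, GF n a d uB i = 0) →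
        ∀ i : ZMod n, uA i < uB i := by
  have hm : 0 < a * (1 - a) := mul_pos ha.1 (sub_pos.2 ha.2)
  have hm1 : a * (1 - a) ≤ 1 := by nlinarith [ha.1, ha.2]
  obtain ⟨ε, hεdef⟩ : ∃ ε, ε = a * (1 - a) / 36 := ⟨_, rfl⟩
  have hε0 : 0 < ε := by rw [hεdef]; positivity
  have hε : ε ≤ 1 := by linarith
  have hεa : 36 * ε ≤ a * (1 - a) := by linarith
  refine ⟨ε * (a * (1 - a)) / 16, by positivity, ε, hε0, fun d ⟨hd0, hd⟩ => ?_⟩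
  have hd' : 16 * d ≤ ε * (a * (1 - a)) := by linarith
  refine ⟨existsUnique_stationary_near ha hA hε0 hε hεa hd0.le hd',
    existsUnique_stationary_near ha hB hε0 hε hεa hd0.le hd', ?_⟩
  intro uA uB huA hGA huB hGB i
  have hAi : ∀ i, |uA i - wA i| ≤ ε := fun i => by
    simpa [Real.dist_eq] using (dist_le_pi_dist uA wA i).trans (Metric.mem_ball.1 huA).le
  have hBi : ∀ i, |uB i - wB i| ≤ ε := fun i => by
    simpa [Real.dist_eq] using (dist_le_pi_dist uB wB i).trans (Metric.mem_ball.1 huB).le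
  have hgap : ∀ i, wA i ≠ wB i → 0 < uB i - uA i := fun i hi => by
    have hsep : a * (1 - a) ≤ wB i - wA i := by
      have hlt := lt_of_le_of_ne (hle i) hi
      rcases hA i with h | h | h <;> rcases hB i with h' | h' | h' <;> rw [h, h'] at hlt ⊢ <;>
        nlinarith [ha.1, ha.2]
    linarith [(abs_le.1 (hAi i)).2, (abs_le.1 (hBi i)).1]
  have heq : ∀ i, uB i - uA i ≤ 0 → wA i = wB i := fun i hi => by
    by_contra h
    exact absurd (hgap i h) hi.not_gt
  refine sub_pos.1 (pos_of_discrete_elliptic hd0 (v := fun i => uB i - uA i)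
    (c := fun i => gSlope a (uB i) (uA i)) (fun i hi => ?_) (fun i _ => ?_) ?_ i)
  · have hi' := heq i hi
    have hbini : wB i = 0 ∨ wB i = 1 := hbin.elim (fun h => hi' ▸ h i) fun h => h i
    have h1 := abs_gSlope_sub_le ha (hB i) hε (hBi i) (hi' ▸ hAi i)
    have h2 := gSlope_self_le_neg ha hbini
    linarith [(abs_le.1 h1).2]
  · have h1 := hGA i
    have h2 := hGB i
    simp only [GF] at h1 h2
    linear_combination h2 - h1 - g_sub_g_s7 a (uB i) (uA i)
  · obtain ⟨j, hj⟩ := Function.ne_iff.1 hne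
    exact ⟨j, hgap j hj⟩
end
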